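/- For all integers x, y, z ≥ 1 and a, b ≥ 1, one has φ_{x+1,y-1,z-1}(a,b) · φ_{x-1,y,z}(a,b) / ( φ_{x,y-1,z-1}(a,b) · φ_{x,y,z}(a,b) ) = x(2x+2a+2b+1) / ( (2x+2y+2z+2a+2b-1)(x+y+z+2a+2b) ). -/

import Mathlib

open Finset Nat

/-- Pochhammer symbol `(q)_n` for real `q` and integer `n`. -/
noncomputable def poch (q : ℝ) (n : ℤ) : ℝ :=
  if 0 ≤ n then ∏ i ∈ Finset.range n.toNat, (q + i)
  else 1 / ∏ i ∈ Finset.range (-n).toNat, (q - (i + 1))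

/-- Skipping Pochhammer symbol `[q]_n`. -/
noncomputable def spoch (q : ℝ) (n : ℤ) : ℝ :=
  if 0 ≤ n then ∏ i ∈ Finset.range n.toNat, (q + 2 * i)
  else 1 / ∏ i ∈ Finset.range (-n).toNat, (q - 2 * (i + 1))

/-- Trapezoidal product `T(q,n,m) = ∏_{i=0}^{m-1} (q+i)_{n-2i}`. -/
noncomputable def trapT (q : ℝ) (n m : ℤ) : ℝ :=
  ∏ i ∈ Finset.range m.toNat, poch (q + i) (n - 2 * i)

/-- Skipping trapezoidal product `V(q,n,m) = ∏_{i=0}^{m-1} [q+2i]_{n-2i}`. -/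
noncomputable def trapV (q : ℝ) (n m : ℤ) : ℝ :=
  ∏ i ∈ Finset.range m.toNat, spoch (q + 2 * i) (n - 2 * i)

/-- Hyperfactorial `H(n) = 0!·1!·2!⋯(n-1)!`. -/
def hyperfac (n : ℕ) : ℕ := ∏ i ∈ Finset.range n, i !

/-- Skipping hyperfactorial `H₂(n)`:
`0!·2!·4!⋯(n-2)!` if `n` is even, `1!·3!·5!⋯(n-2)!` if `n` is odd. -/
def hyperfac2 (n : ℕ) : ℕ :=
  ∏ i ∈ Finset.range (n / 2), (if n % 2 = 0 then (2 * i)! else (2 * i + 1)!)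

/-- Partial sum `s_k(t) = t 1 + ⋯ + t k` (sequences are indexed from 1). -/
def pSum (t : ℕ → ℕ) (k : ℕ) : ℕ := ∑ i ∈ Finset.Icc 1 k, t i

/-- `E(t) = t 2 + t 4 + ⋯ + t (2l)` for a sequence of length `2l`. -/
def evenSum (l : ℕ) (t : ℕ → ℕ) : ℕ := ∑ i ∈ Finset.Icc 1 l, t (2 * i)

/-- `Q(t₁,…,t_{2l})`. -/
noncomputable def Qfun (l : ℕ) (t : ℕ → ℕ) : ℝ :=
  ((∏ i ∈ Finset.Icc 1 l, ((pSum t (2 * i))! : ℝ) / ((pSum t (2 * i - 1))! : ℝ)) /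
      (hyperfac2 (2 * evenSum l t + 1) : ℝ)) *
    (∏ i ∈ Finset.Icc 1 l,
      ((hyperfac2 (2 * pSum t (2 * i) + 1) : ℝ) * (hyperfac (2 * pSum t (2 * i - 1) + 2) : ℝ)) /
        (hyperfac2 (2 * pSum t (2 * i - 1) + 3) : ℝ)) *
    (∏ p ∈ (Finset.Icc 1 (2 * l) ×ˢ Finset.Icc 1 (2 * l)).filter
        (fun p => p.1 < p.2 ∧ (p.2 - p.1) % 2 = 1),
      (hyperfac (pSum t p.2 - pSum t p.1) : ℝ) / (hyperfac (pSum t p.2 + pSum t p.1 + 1) : ℝ)) *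
    (∏ p ∈ (Finset.Icc 1 (2 * l) ×ˢ Finset.Icc 1 (2 * l)).filter
        (fun p => p.1 < p.2 ∧ (p.2 - p.1) % 2 = 0),
      (hyperfac (pSum t p.2 + pSum t p.1 + 1) : ℝ) / (hyperfac (pSum t p.2 - pSum t p.1) : ℝ))

/-- Build an indexed-from-1 sequence from a list. -/
def seqOf (L : List ℕ) : ℕ → ℕ := fun i => L.getD (i - 1) 0

/-- `Q` on four entries. -/
noncomputable def Q4 (t1 t2 t3 t4 : ℕ) : ℝ := Qfun 2 (seqOf [t1, t2, t3, t4])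

/-- Proctor's product formula `P_{a,b,c}`. -/
noncomputable def Pf (a b c : ℕ) : ℝ :=
  ∏ i ∈ Finset.Icc 1 a,
    ((∏ j ∈ Finset.Icc 1 (b - a + 1), ((c + i + j - 1 : ℕ) : ℝ) / ((i + j - 1 : ℕ) : ℝ)) *
      ∏ j ∈ Finset.Icc (b - a + 2) (b - a + i),
        ((2 * c + i + j - 1 : ℕ) : ℝ) / ((i + j - 1 : ℕ) : ℝ))

/-- Ciucu's product formula `P′_{a,b,c}`. -/
noncomputable def Pf' (a b c : ℕ) : ℝ :=
  (2 : ℝ) ^ (-(a : ℤ)) *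
    (∏ i ∈ Finset.Icc 1 a, ((2 * c + (b - a) + i : ℕ) : ℝ) / ((c + (b - a) + i : ℕ) : ℝ)) *
    Pf a b c

/-- `φ_{x,y,z}(a,b)`. -/
noncomputable def phi (x y z a b : ℕ) : ℝ :=
  (Pf y (y + 2 * a) b * Pf (z + b) (z + b) a * Q4 a b x (y + z) /
      Pf (y + z + b) (y + z + b) a) *
    (trapT ((x : ℝ) + b + 1) ((y : ℤ) + a - 1) a *
      trapT ((x : ℝ) + z + a + b + 2) ((y : ℤ) + a - 1) a *
      trapT (2 * (a : ℝ) + b + 2) ((y : ℤ) + b - 1) b *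
      trapT ((z : ℝ) + 1) ((y : ℤ) + b - 1) b) /
    (trapT ((b : ℝ) + 1) ((y : ℤ) + a - 1) a *
      trapT ((z : ℝ) + a + b + 2) ((y : ℤ) + a - 1) a *
      trapT ((x : ℝ) + 2 * a + b + 2) ((y : ℤ) + b - 1) b *
      trapT ((x : ℝ) + z + 1) ((y : ℤ) + b - 1) b)

/-- `ψ_{x,y,z}(a,b)`. -/
noncomputable def psi (x y z a b : ℕ) : ℝ :=
  (Pf' y (y + 2 * a + 1) b * Pf (z + b) (z + b) a * Q4 a b x (y + z) /
      Pf (y + z + b) (y + z + b) a) *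
    (trapV (2 * (a : ℝ) + 2 * b + 3) ((y : ℤ) + z - 1) y /
      trapV (2 * (x : ℝ) + 2 * a + 2 * b + 3) ((y : ℤ) + z - 1) y) *
    (trapT ((x : ℝ) + b + 1) ((y : ℤ) + z + 2 * a) y *
      trapT (2 * (a : ℝ) + b + 2) ((y : ℤ) + b - 1) b *
      trapT ((z : ℝ) + 1) ((y : ℤ) + b - 1) b) /
    (trapT ((b : ℝ) + 1) ((y : ℤ) + z + 2 * a) y *
      trapT ((x : ℝ) + 2 * a + b + 2) ((y : ℤ) + b - 1) b *
      trapT ((x : ℝ) + z + 1) ((y : ℤ) + b - 1) b)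

lemma poch_fac (q p : ℕ) (n : ℤ) (h : (q : ℤ) + n = p) :
    poch ((q : ℝ) + 1) n = (p ! : ℝ) / (q ! : ℝ) := by
  unfold poch
  split_ifs with hn
  · obtain ⟨k, rfl⟩ := Int.eq_ofNat_of_zero_le hn
    have hp : p = q + k := by omega
    subst hp
    clear h hn
    rw [eq_div_iff (by positivity)]
    simp only [Int.toNat_natCast]
    induction k with
    | zero => simp
    | succ k ih =>
      rw [Finset.prod_range_succ, mul_right_comm, ih, ← add_assoc, Nat.factorial_succ]
      push_cast; ring
  · obtain ⟨k, rfl⟩ : ∃ k : ℕ, n = -(k : ℤ) := ⟨(-n).toNat, by omega⟩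
    have hp : q = p + k := by omega
    subst hp
    clear h hn
    simp only [neg_neg, Int.toNat_natCast]
    have key : (∏ i ∈ Finset.range k, (((p + k : ℕ) : ℝ) + 1 - ((i : ℝ) + 1))) * (p ! : ℝ)
        = ((p + k)! : ℝ) := by
      induction k with
      | zero => simp
      | succ k ih =>
        rw [Finset.prod_range_succ', ← add_assoc, Nat.factorial_succ]
        push_cast at ih ⊢
        rw [← ih]
        have : ∀ i ∈ Finset.range k, ((p : ℝ) + k + 1 + 1 - (i + 1 + 1))
          = (p : ℝ) + k + 1 - (i + 1) := by intros; ring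
        rw [Finset.prod_congr rfl this]
        ring
    have h1 : ((p + k)! : ℝ) ≠ 0 := by positivity
    have h2 : (∏ i ∈ Finset.range k, (((p + k : ℕ) : ℝ) + 1 - ((i : ℝ) + 1))) ≠ 0 := by
      intro h0; rw [h0, zero_mul] at key; exact h1 key.symm
    rw [div_eq_div_iff h2 h1, one_mul, ← key]; ring

lemma hf_pos (n : ℕ) : (0 : ℝ) < (hyperfac n : ℝ) := by
  unfold hyperfac
  exact_mod_cast Finset.prod_pos (fun i _ => Nat.factorial_pos i)

lemma hf_succ (n : ℕ) : (hyperfac (n + 1) : ℝ) = hyperfac n * (n ! : ℝ) := by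
  unfold hyperfac
  rw [Finset.prod_range_succ]; push_cast; ring

lemma hf_add (q m : ℕ) : (hyperfac (q + m) : ℝ)
    = hyperfac q * ∏ i ∈ Finset.range m, ((q + i)! : ℝ) := by
  unfold hyperfac
  rw [Finset.prod_range_add]; push_cast; ring

lemma hf2_pos (n : ℕ) : (0 : ℝ) < (hyperfac2 n : ℝ) := by
  unfold hyperfac2
  rw [Nat.cast_pos]
  refine Finset.prod_pos (fun i _ => ?_)
  split_ifs <;> exact Nat.factorial_pos _

lemma hf2_succ (n : ℕ) : (hyperfac2 (2 * (n + 1) + 1) : ℝ)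
    = hyperfac2 (2 * n + 1) * ((2 * n + 1)! : ℝ) := by
  unfold hyperfac2
  rw [show (2 * (n + 1) + 1) / 2 = n + 1 by omega, show (2 * n + 1) / 2 = n by omega,
    show (2 * (n + 1) + 1) % 2 = 1 by omega, show (2 * n + 1) % 2 = 1 by omega,
    Finset.prod_range_succ]
  push_cast; simp

lemma trapT_hf (r : ℝ) (q y a : ℕ) (hr : r = (q : ℝ) + 1) :
    trapT r ((y : ℤ) + a - 1) a = ((hyperfac (q + y + a) : ℝ) * hyperfac q) /
      (hyperfac (q + y) * hyperfac (q + a)) := by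
  subst hr
  unfold trapT
  have h1 : ∀ i ∈ Finset.range (a : ℤ).toNat,
      poch ((q : ℝ) + 1 + i) ((y : ℤ) + a - 1 - 2 * i)
        = ((q + y + (a - 1 - i))! : ℝ) / ((q + i)! : ℝ) := by
    intro i hi
    simp only [Int.toNat_natCast, Finset.mem_range] at hi
    rw [← poch_fac (q + i) (q + y + (a - 1 - i)) ((y : ℤ) + a - 1 - 2 * i) (by omega)]
    congr 1
    push_cast; ring
  rw [Finset.prod_congr rfl h1, Finset.prod_div_distrib]
  simp only [Int.toNat_natCast]
  rw [Finset.prod_range_reflect (fun j => ((q + y + j)! : ℝ)) a, hf_add (q + y) a, hf_add q a]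
  have := (hf_pos q).ne'
  have := (hf_pos (q + y)).ne'
  have : (∏ i ∈ Finset.range a, ((q + i)! : ℝ)) ≠ 0 :=
    Finset.prod_ne_zero_iff.2 (fun i _ => by positivity)
  field_simp

lemma trapT_ne (r : ℝ) (q y a : ℕ) (hr : r = (q : ℝ) + 1) :
    trapT r ((y : ℤ) + a - 1) a ≠ 0 := by
  rw [trapT_hf r q y a hr]
  have := hf_pos (q + y + a)
  have := hf_pos q
  have := hf_pos (q + y)
  have := hf_pos (q + a)
  positivity

lemma trapT_step (r r' : ℝ) (q y a : ℕ) (hr : r = (q : ℝ) + 1) (hr' : r' = (q : ℝ) + 2) :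
    trapT r' ((y : ℤ) + a - 1) a = trapT r ((y : ℤ) + a - 1) a *
      ((((q + y + a)! : ℝ) * (q ! : ℝ)) / (((q + y)! : ℝ) * ((q + a)! : ℝ))) := by
  rw [trapT_hf r q y a hr, trapT_hf r' (q + 1) y a (by rw [hr']; push_cast; ring)]
  rw [show q + 1 + y + a = q + y + a + 1 by ring, show q + 1 + y = q + y + 1 by ring,
    show q + 1 + a = q + a + 1 by ring]
  simp only [hf_succ]
  have := (hf_pos (q + y)).ne'
  have := (hf_pos (q + a)).ne'
  field_simp

lemma Pf_ne (a b c : ℕ) : Pf a b c ≠ 0 := by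
  unfold Pf
  refine Finset.prod_ne_zero_iff.2 (fun i hi => mul_ne_zero ?_ ?_) <;>
  · refine Finset.prod_ne_zero_iff.2 (fun j hj => ?_)
    rw [Finset.mem_Icc] at hi hj
    refine div_ne_zero ?_ ?_ <;> · rw [Nat.cast_ne_zero]; omega

lemma Q4_eq (a b x w : ℕ) : Q4 a b x w =
    (((a + b)! : ℝ) / (a ! : ℝ) * (((a + b + x + w)! : ℝ) / ((a + b + x)! : ℝ)) /
      hyperfac2 (2 * (b + w) + 1)) *
    ((hyperfac2 (2 * (a + b) + 1) * hyperfac (2 * a + 2) / hyperfac2 (2 * (a + 1) + 1)) *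
     (hyperfac2 (2 * (a + b + x + w) + 1) * hyperfac (2 * (a + b + x) + 2) /
        hyperfac2 (2 * (a + b + x + 1) + 1))) *
    ((hyperfac b / hyperfac (a + b + a + 1) : ℝ) *
     (hyperfac (b + x + w) / hyperfac (a + b + x + w + a + 1)) *
     (hyperfac x / hyperfac (a + b + x + (a + b) + 1)) *
     (hyperfac w / hyperfac (a + b + x + w + (a + b + x) + 1))) *
    ((hyperfac (a + b + x + a + 1) / hyperfac (b + x)) *
     (hyperfac (a + b + x + w + (a + b) + 1) / hyperfac (x + w))) := by
  have p1 : pSum (seqOf [a, b, x, w]) 1 = a := by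
    simp [pSum, seqOf]
  have p2 : pSum (seqOf [a, b, x, w]) 2 = a + b := by
    simp [pSum, seqOf, Finset.sum_Icc_succ_top]
  have p3 : pSum (seqOf [a, b, x, w]) 3 = a + b + x := by
    simp [pSum, seqOf, Finset.sum_Icc_succ_top]
  have p4 : pSum (seqOf [a, b, x, w]) 4 = a + b + x + w := by
    simp [pSum, seqOf, Finset.sum_Icc_succ_top]
  have e : evenSum 2 (seqOf [a, b, x, w]) = b + w := by
    simp [evenSum, seqOf, Finset.sum_Icc_succ_top]
  unfold Q4 Qfun
  rw [show (Finset.Icc 1 (2 * 2) ×ˢ Finset.Icc 1 (2 * 2)).filter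
        (fun p : ℕ × ℕ => p.1 < p.2 ∧ (p.2 - p.1) % 2 = 1)
        = {(1, 2), (1, 4), (2, 3), (3, 4)} by decide,
    show (Finset.Icc 1 (2 * 2) ×ˢ Finset.Icc 1 (2 * 2)).filter
        (fun p : ℕ × ℕ => p.1 < p.2 ∧ (p.2 - p.1) % 2 = 0)
        = {(1, 3), (2, 4)} by decide,
    show Finset.Icc 1 2 = {1, 2} by decide, e]
  rw [Finset.prod_pair (by decide), Finset.prod_pair (by decide), Finset.prod_pair (by decide)]
  rw [Finset.prod_insert (by decide), Finset.prod_insert (by decide),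
    Finset.prod_pair (by decide)]
  simp only [show 2 * 1 = 2 by rfl, show 2 * 2 = 4 by rfl, show 2 - 1 = 1 by rfl,
    show 4 - 1 = 3 by rfl, p1, p2, p3, p4]
  rw [show a + b - a = b by omega, show a + b + x + w - a = b + x + w by omega,
    show a + b + x - (a + b) = x by omega, show a + b + x + w - (a + b + x) = w by omega,
    show a + b + x - a = b + x by omega, show a + b + x + w - (a + b) = x + w by omega,
    show 2 * a + 3 = 2 * (a + 1) + 1 by ring,
    show 2 * (a + b + x) + 3 = 2 * (a + b + x + 1) + 1 by ring]
  ring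

/-- step factor of Q4 -/
noncomputable def Qr (a b x w : ℕ) : ℝ :=
  (((a + b + x + w : ℕ) : ℝ) + 1) / (((a + b + x : ℕ) : ℝ) + 1) *
  (((2 * (a + b + x + w) + 1)! : ℝ) * ((2 * (a + b + x) + 2)! : ℝ)) *
  (((b + x + w)! : ℝ) / ((a + b + x + w + a + 1)! : ℝ)) *
  ((x ! : ℝ) / ((a + b + x + (a + b) + 1)! : ℝ)) *
  (1 / (((a + b + x + w + (a + b + x) + 1)! : ℝ) * ((a + b + x + w + (a + b + x) + 2)! : ℝ))) *
  (((a + b + x + a + 1)! : ℝ) / ((b + x)! : ℝ)) *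
  (((a + b + x + w + (a + b) + 1)! : ℝ) / ((x + w)! : ℝ))

lemma Q4_ne (a b x w : ℕ) : Q4 a b x w ≠ 0 := by
  rw [Q4_eq]
  have h1 : ∀ n, (hyperfac n : ℝ) ≠ 0 := fun n => (hf_pos n).ne'
  have h2 : ∀ n, (hyperfac2 n : ℝ) ≠ 0 := fun n => (hf2_pos n).ne'
  have h3 : ∀ n : ℕ, (n ! : ℝ) ≠ 0 := fun n => by positivity
  simp [h1, h2, h3]

lemma Q4_step (a b x w : ℕ) : Q4 a b (x + 1) w = Q4 a b x w * Qr a b x w := by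
  rw [Q4_eq, Q4_eq, Qr]
  rw [show a + b + (x + 1) + w = a + b + x + w + 1 by ring,
    show a + b + (x + 1) = a + b + x + 1 by ring,
    show b + (x + 1) + w = b + x + w + 1 by ring,
    show a + b + x + w + 1 + a + 1 = a + b + x + w + a + 1 + 1 by ring,
    show a + b + x + 1 + (a + b) + 1 = a + b + x + (a + b) + 1 + 1 by ring,
    show a + b + x + w + 1 + (a + b + x + 1) + 1 = a + b + x + w + (a + b + x) + 1 + 1 + 1 by ring,
    show a + b + x + 1 + a + 1 = a + b + x + a + 1 + 1 by ring,
    show b + (x + 1) = b + x + 1 by ring,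
    show a + b + x + w + 1 + (a + b) + 1 = a + b + x + w + (a + b) + 1 + 1 by ring,
    show x + 1 + w = x + w + 1 by ring,
    show 2 * (a + b + x + 1) + 2 = 2 * (a + b + x) + 2 + 1 + 1 by ring]
  rw [hf2_succ (a + b + x + w), hf2_succ (a + b + x + 1), hf_succ (b + x + w),
    hf_succ (a + b + x + w + a + 1), hf_succ x, hf_succ (a + b + x + (a + b) + 1),
    hf_succ (a + b + x + w + (a + b + x) + 1 + 1), hf_succ (a + b + x + w + (a + b + x) + 1),
    hf_succ (a + b + x + a + 1), hf_succ (b + x), hf_succ (a + b + x + w + (a + b) + 1),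
    hf_succ (x + w), hf_succ (2 * (a + b + x) + 2 + 1), hf_succ (2 * (a + b + x) + 2),
    Nat.factorial_succ (a + b + x + w), Nat.factorial_succ (a + b + x),
    show 2 * (a + b + x + 1) + 1 = 2 * (a + b + x) + 2 + 1 by ring,
    show a + b + x + w + (a + b + x) + 2 = a + b + x + w + (a + b + x) + 1 + 1 by ring]
  have h1 : ∀ n, (hyperfac n : ℝ) ≠ 0 := fun n => (hf_pos n).ne'
  have h2 : ∀ n, (hyperfac2 n : ℝ) ≠ 0 := fun n => (hf2_pos n).ne'
  have h3 : ∀ n : ℕ, (n ! : ℝ) ≠ 0 := fun n => by positivity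
  have h4 : ((a + b + x : ℕ) : ℝ) + 1 ≠ 0 := by positivity
  rw [Nat.cast_mul, Nat.cast_mul, Nat.cast_succ, Nat.cast_succ]
  field_simp [h1, h2, h3, h4]

/-- step factor of trapT -/
noncomputable def Tr (q y a : ℕ) : ℝ :=
  (((q + y + a)! : ℝ) * (q ! : ℝ)) / (((q + y)! : ℝ) * ((q + a)! : ℝ))

lemma phi_ne (x y z a b : ℕ) : phi x y z a b ≠ 0 := by
  unfold phi
  have t1 := trapT_ne ((x : ℝ) + b + 1) (x + b) y a (by push_cast; ring)
  have t2 := trapT_ne ((x : ℝ) + z + a + b + 2) (x + z + a + b + 1) y a (by push_cast; ring)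
  have t3 := trapT_ne (2 * (a : ℝ) + b + 2) (2 * a + b + 1) y b (by push_cast; ring)
  have t4 := trapT_ne ((z : ℝ) + 1) z y b (by push_cast; ring)
  have t5 := trapT_ne ((b : ℝ) + 1) b y a (by push_cast; ring)
  have t6 := trapT_ne ((z : ℝ) + a + b + 2) (z + a + b + 1) y a (by push_cast; ring)
  have t7 := trapT_ne ((x : ℝ) + 2 * a + b + 2) (x + 2 * a + b + 1) y b (by push_cast; ring)
  have t8 := trapT_ne ((x : ℝ) + z + 1) (x + z) y b (by push_cast; ring)
  simp only [ne_eq, _root_.div_eq_zero_iff, _root_.mul_eq_zero, Pf_ne, Q4_ne, t1, t2, t3, t4, t5, t6, t7, t8,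
    or_self, not_false_eq_true]

lemma phi_step (x y z a b : ℕ) : phi (x + 1) y z a b = phi x y z a b *
    (Qr a b x (y + z) * Tr (x + b) y a * Tr (x + z + a + b + 1) y a /
      (Tr (x + 2 * a + b + 1) y b * Tr (x + z) y b)) := by
  unfold phi Tr
  rw [Q4_step,
    trapT_step ((x : ℝ) + b + 1) (((x + 1 : ℕ) : ℝ) + b + 1) (x + b) y a
      (by push_cast; ring) (by push_cast; ring),
    trapT_step ((x : ℝ) + z + a + b + 2) (((x + 1 : ℕ) : ℝ) + z + a + b + 2) (x + z + a + b + 1) y a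
      (by push_cast; ring) (by push_cast; ring),
    trapT_step ((x : ℝ) + 2 * a + b + 2) (((x + 1 : ℕ) : ℝ) + 2 * a + b + 2) (x + 2 * a + b + 1) y b
      (by push_cast; ring) (by push_cast; ring),
    trapT_step ((x : ℝ) + z + 1) (((x + 1 : ℕ) : ℝ) + z + 1) (x + z) y b
      (by push_cast; ring) (by push_cast; ring)]
  simp only [div_eq_mul_inv, mul_inv]
  ring

lemma Tr_ne (q y a : ℕ) : Tr q y a ≠ 0 := by unfold Tr; positivity
lemma Qr_ne (a b x w : ℕ) : Qr a b x w ≠ 0 := by unfold Qr; positivity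

lemma fs (m n : ℕ) (h : m = n + 1) : (m ! : ℝ) = ((n : ℝ) + 1) * (n ! : ℝ) := by
  subst h; rw [Nat.factorial_succ]; push_cast; ring

lemma Tr1 (q y a : ℕ) : Tr (q + 1) y a * (q + a + 1) = Tr q (y + 1) a * (q + 1) := by
  unfold Tr
  rw [show q + 1 + y = q + (y + 1) by ring, fs (q + 1) q rfl, fs (q + 1 + a) (q + a) (by ring)]
  push_cast
  field_simp

lemma Tr2 (q y a : ℕ) : Tr q (y + 1) a * (q + y + 1) = Tr q y a * (q + y + a + 1) := by
  unfold Tr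
  rw [fs (q + (y + 1)) (q + y) (by ring), fs (q + (y + 1) + a) (q + y + a) (by ring)]
  push_cast
  field_simp

lemma fs' (m n : ℕ) (c : ℝ) (h : m = n + 1) (hc : c = (n : ℝ) + 1) :
    (m ! : ℝ) = c * (n ! : ℝ) := by
  rw [hc]; exact fs m n h

lemma Q_alg (F1 F2 F3 F4 F5 F6 F7 F8 F9 F10 F11 F12 u v c1 c2 c3 c4 c5 c6 c7 c8 n1 n2 d1 d2 : ℝ)
    (hv : v ≠ 0) (h1 : c1 ≠ 0) (h3 : c3 ≠ 0) (h5 : c5 ≠ 0) (h7 : c7 ≠ 0) (h8 : c8 ≠ 0) :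
    (u / v * (F1 * ((2 * v) * (n2 * F2))) * (F3 / F4) * (n1 * F5 / (c7 * F6)) * (1 / (F7 * F8)) *
      (c4 * F9 / (c8 * F10)) * (F11 / F12)) * (c2 * d1 * c6 * c7 * c8 * d2) =
    (c2 / c1 * ((d1 * ((2 * u) * F1)) * F2) * (c6 * F3 / (c3 * F4)) * (F5 / F6) * (1 / (F7 * F8)) *
      (F9 / F10) * (d2 * F11 / (c5 * F12))) * (c1 * n1 * n2 * c3 * c4 * c5) := by
  trans (v / v) * (c7 / c7) * (c8 / c8) * ((2 * u * n1 * n2 * c4 * c2 * d1 * c6 * d2) *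
    (F1 * F2 * (F3 / F4) * (F5 / F6) * (1 / (F7 * F8)) * (F9 / F10) * (F11 / F12)))
  · simp only [div_eq_mul_inv, mul_inv]; ring
  trans (c1 / c1) * (c3 / c3) * (c5 / c5) * ((2 * u * n1 * n2 * c4 * c2 * d1 * c6 * d2) *
    (F1 * F2 * (F3 / F4) * (F5 / F6) * (1 / (F7 * F8)) * (F9 / F10) * (F11 / F12)))
  · rw [div_self hv, div_self h7, div_self h8, div_self h1, div_self h3, div_self h5]
  · simp only [div_eq_mul_inv, mul_inv]; ring

lemma Qr1 (a b x w : ℕ) : Qr a b (x + 1) w *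
    (((a : ℝ) + b + x + w + 3) * (2 * (a + b + x + w) + 5) * (b + x + w + 2) *
      (2 * a + 2 * b + x + 2) * (b + x + 1) * (2 * a + 2 * b + x + w + 3)) =
    Qr a b x (w + 2) * (((a : ℝ) + b + x + 1) * (x + 1) * (2 * (a + b + x) + 3) *
      (2 * a + b + x + w + 3) * (2 * a + b + x + 2) * (x + w + 2)) := by
  unfold Qr
  rw [show a + b + (x + 1) = a + b + x + 1 by ring,
    show a + b + x + (w + 2) = a + b + x + w + 2 by ring,
    show a + b + x + 1 + w = a + b + x + w + 1 by ring,
    show b + (x + 1) + w = b + x + w + 1 by ring,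
    show b + x + (w + 2) = b + x + w + 2 by ring,
    show a + b + x + w + 1 + (a + b + x + 1) = a + b + x + w + 2 + (a + b + x) by ring,
    show x + (w + 2) = x + 1 + w + 1 by ring,
    show ((a + b + x + w + 1 : ℕ) : ℝ) + 1 = a + b + x + w + 2 by push_cast; ring,
    show ((a + b + x + 1 : ℕ) : ℝ) + 1 = a + b + x + 2 by push_cast; ring,
    show ((a + b + x + w + 2 : ℕ) : ℝ) + 1 = a + b + x + w + 3 by push_cast; ring,
    show ((a + b + x : ℕ) : ℝ) + 1 = a + b + x + 1 by push_cast; ring,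
    fs' (2 * (a + b + x + w + 2) + 1) (2 * (a + b + x + w + 1) + 1 + 1)
      (2 * (a + b + x + w) + 5) (by ring) (by push_cast; ring),
    fs' (2 * (a + b + x + w + 1) + 1 + 1) (2 * (a + b + x + w + 1) + 1)
      (2 * (a + b + x + w + 2)) (by ring) (by push_cast; ring),
    fs' (2 * (a + b + x + 1) + 2) (2 * (a + b + x) + 2 + 1)
      (2 * (a + b + x + 2)) (by ring) (by push_cast; ring),
    fs' (2 * (a + b + x) + 2 + 1) (2 * (a + b + x) + 2)
      (2 * (a + b + x) + 3) (by ring) (by push_cast; ring),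
    fs' (b + x + w + 2) (b + x + w + 1) (b + x + w + 2) (by ring) (by push_cast; ring),
    fs' (a + b + x + w + 2 + a + 1) (a + b + x + w + 1 + a + 1)
      (2 * a + b + x + w + 3) (by ring) (by push_cast; ring),
    fs' (x + 1) x (x + 1) rfl rfl,
    fs' (a + b + x + 1 + (a + b) + 1) (a + b + x + (a + b) + 1)
      (2 * a + 2 * b + x + 2) (by ring) (by push_cast; ring),
    fs' (a + b + x + 1 + a + 1) (a + b + x + a + 1)
      (2 * a + b + x + 2) (by ring) (by push_cast; ring),
    fs' (b + (x + 1)) (b + x) (b + x + 1) (by ring) (by push_cast; ring),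
    fs' (a + b + x + w + 2 + (a + b) + 1) (a + b + x + w + 1 + (a + b) + 1)
      (2 * a + 2 * b + x + w + 3) (by ring) (by push_cast; ring),
    fs' (x + 1 + w + 1) (x + 1 + w) (x + w + 2) (by ring) (by push_cast; ring)]
  apply Q_alg <;> positivity

lemma ratio_alg (f g Q0 Q1 A A1 B B1 C C1 D D1 c1 c2 c3 c4 c5 c6 c7 c8 n1 n2 d1 d2 : ℝ)
    (hf : f ≠ 0) (hg : g ≠ 0) (hQ : Q0 ≠ 0) (hA : A ≠ 0) (hB : B ≠ 0) (hC : C ≠ 0) (hD : D ≠ 0)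
    (h1 : c1 ≠ 0) (h2 : c2 ≠ 0) (h3 : c3 ≠ 0) (h4 : c4 ≠ 0) (h5 : c5 ≠ 0) (h6 : c6 ≠ 0)
    (h7 : c7 ≠ 0) (h8 : c8 ≠ 0) (k1 : d1 ≠ 0) (k2 : d2 ≠ 0)
    (eQ : Q1 * (c2 * d1 * c6 * c7 * c8 * d2) = Q0 * (c1 * n1 * n2 * c3 * c4 * c5))
    (eA : A1 * c1 = A * c8) (eB : B1 * c2 = B * c3) (eC : C1 * c7 = C * c4)
    (eD : D1 * c5 = D * c6) :
    f * (Q1 * A1 * B / (C1 * D)) * g / (f * (g * (Q0 * A * B1 / (C * D1)))) =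
      n1 * n2 / (d1 * d2) := by
  rw [← eq_div_iff (by positivity)] at eQ eA eB eC eD
  subst eQ eA eB eC eD
  field_simp

/-- second ratio of `φ`'s in the Kuo recurrence. -/
theorem claim_phi_ratio_two (x y z a b : ℕ) (hx : 1 ≤ x) (hy : 1 ≤ y) (hz : 1 ≤ z)
    (ha : 1 ≤ a) (hb : 1 ≤ b) :
    phi (x + 1) (y - 1) (z - 1) a b * phi (x - 1) y z a b /
        (phi x (y - 1) (z - 1) a b * phi x y z a b) =
      (x : ℝ) * (2 * (x : ℝ) + 2 * a + 2 * b + 1) /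
        ((2 * (x : ℝ) + 2 * y + 2 * z + 2 * a + 2 * b - 1) *
          ((x : ℝ) + y + z + 2 * a + 2 * b)) := by
  obtain ⟨x, rfl⟩ := Nat.exists_eq_add_of_le' hx
  obtain ⟨y, rfl⟩ := Nat.exists_eq_add_of_le' hy
  obtain ⟨z, rfl⟩ := Nat.exists_eq_add_of_le' hz
  simp only [Nat.add_sub_cancel]
  rw [phi_step (x + 1) y z, phi_step x (y + 1) (z + 1)]
  have n1 := phi_ne (x + 1) y z a b
  have n2 := phi_ne x (y + 1) (z + 1) a b
  rw [show y + 1 + (z + 1) = y + z + 2 by ring, show x + 1 + b = x + b + 1 by ring,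
    show x + 1 + z + a + b + 1 = x + z + a + b + 2 by ring,
    show x + (z + 1) + a + b + 1 = x + z + a + b + 2 by ring,
    show x + 1 + 2 * a + b + 1 = x + 2 * a + b + 1 + 1 by ring,
    show x + 1 + z = x + z + 1 by ring, show x + (z + 1) = x + z + 1 by ring]
  have q := Qr1 a b x (y + z)
  have e1 := Tr1 (x + b) y a
  have e2 := Tr2 (x + z + a + b + 2) y a
  have e3 := Tr1 (x + 2 * a + b + 1) y b
  have e4 := Tr2 (x + z + 1) y b
  have m0 := Qr_ne a b x (y + z + 2)
  have m1 := Tr_ne (x + b) (y + 1) a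
  have m2 := Tr_ne (x + z + a + b + 2) y a
  have m3 := Tr_ne (x + 2 * a + b + 1) (y + 1) b
  have m4 := Tr_ne (x + z + 1) y b
  have hd : (2 * ((x + 1 : ℕ) : ℝ) + 2 * ((y + 1 : ℕ) : ℝ) + 2 * ((z + 1 : ℕ) : ℝ)
      + 2 * a + 2 * b - 1) = 2 * (a + b + x + (y + z)) + 5 := by push_cast; ring
  have hd2 : ((x + 1 : ℕ) : ℝ) + ((y + 1 : ℕ) : ℝ) + ((z + 1 : ℕ) : ℝ)
      + 2 * a + 2 * b = 2 * a + 2 * b + x + (y + z) + 3 := by push_cast; ring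
  have hn : 2 * ((x + 1 : ℕ) : ℝ) + 2 * a + 2 * b + 1 = 2 * (a + b + x) + 3 := by
    push_cast; ring
  rw [hd, hd2, hn, Nat.cast_succ x]
  push_cast at q e1 e2 e3 e4
  refine ratio_alg _ _ _ _ _ _ _ _ _ _ _ _ (a + b + x + 1) (a + b + x + (y + z) + 3)
    (2 * a + b + x + (y + z) + 3) (2 * a + b + x + 2) (x + (y + z) + 2) (b + x + (y + z) + 2)
    (2 * a + 2 * b + x + 2) (b + x + 1) _ _ _ _ n1 n2 m0 m1 m2 m3 m4
    (by positivity) (by positivity) (by positivity) (by positivity) (by positivity)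
    (by positivity) (by positivity) (by positivity) (by positivity) (by positivity)
    ?_ ?_ ?_ ?_ ?_
  · exact q
  · linear_combination e1
  · linear_combination e2
  · linear_combination e3
  · linear_combination e4
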